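/- Let F be a cellular automaton on a closed σ-invariant set X ⊆ A^ℤ and μ a σ-ergodic and F-invariant Borel probability measure. If F has an equicontinuous point belonging to the topological support S(μ), then the average Lyapunov exponents vanish, I_μ⁺ = I_μ⁻ = 0, and the metric entropy of F vanishes, h_μ(F) = 0. -/

import Mathlib

open MeasureTheory Filter Topology Set

noncomputable section

/-- The shift map `σ` on `ℤ → A`, defined by `(σ x) i = x (i + 1)`. -/
def shiftMap (A : Type*) : (ℤ → A) → (ℤ → A) := fun x i => x (i + 1)

/-- The iterate `σ^j` of the shift, for `j : ℤ`: `(σ^j x) i = x (i + j)`. -/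
def shiftIter {A : Type*} (j : ℤ) (x : ℤ → A) : ℤ → A := fun i => x (i + j)

/-- `F` admits a local rule of radius `r`:
`F(x)_i = f (x_{i-r}, …, x_{i+r})` for a block map `f : A^{2r+1} → A`. -/
def HasLocalRule {A : Type*} (F : (ℤ → A) → (ℤ → A)) (r : ℕ) : Prop :=
  ∃ f : (Fin (2 * r + 1) → A) → A, ∀ (x : ℤ → A) (i : ℤ),
    F x i = f fun j => x (i - (r : ℤ) + ((j : ℕ) : ℤ))

/-- `W_s⁺(x) = {y ∈ X : y_i = x_i for all i ≥ s}`. -/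
def Wplus {A : Type*} (X : Set (ℤ → A)) (s : ℤ) (x : ℤ → A) : Set (ℤ → A) :=
  {y ∈ X | ∀ i : ℤ, s ≤ i → y i = x i}

/-- `W_s⁻(x) = {y ∈ X : y_i = x_i for all i ≤ s}`. -/
def Wminus {A : Type*} (X : Set (ℤ → A)) (s : ℤ) (x : ℤ → A) : Set (ℤ → A) :=
  {y ∈ X | ∀ i : ℤ, i ≤ s → y i = x i}

/-- `Λ̃ₙ⁺(x) = min{s ≥ 0 : F^i(W₀⁺(x)) ⊆ W_s⁺(F^i(x)) for all 1 ≤ i ≤ n}`. -/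
def lamTildeP {A : Type*} (X : Set (ℤ → A)) (F : (ℤ → A) → (ℤ → A)) (n : ℕ)
    (x : ℤ → A) : ℕ :=
  sInf {s : ℕ | ∀ i : ℕ, 1 ≤ i → i ≤ n →
    F^[i] '' Wplus X 0 x ⊆ Wplus X (s : ℤ) (F^[i] x)}

/-- `Λ̃ₙ⁻(x) = min{s ≥ 0 : F^i(W₀⁻(x)) ⊆ W_{-s}⁻(F^i(x)) for all 1 ≤ i ≤ n}`. -/
def lamTildeM {A : Type*} (X : Set (ℤ → A)) (F : (ℤ → A) → (ℤ → A)) (n : ℕ)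
    (x : ℤ → A) : ℕ :=
  sInf {s : ℕ | ∀ i : ℕ, 1 ≤ i → i ≤ n →
    F^[i] '' Wminus X 0 x ⊆ Wminus X (-(s : ℤ)) (F^[i] x)}

/-- `Λₙ⁺(x) = max_{j ∈ ℤ} Λ̃ₙ⁺(σ^j x)`. -/
def lamP {A : Type*} (X : Set (ℤ → A)) (F : (ℤ → A) → (ℤ → A)) (n : ℕ)
    (x : ℤ → A) : ℕ :=
  sSup (Set.range fun j : ℤ => lamTildeP X F n (shiftIter j x))

/-- `Λₙ⁻(x) = max_{j ∈ ℤ} Λ̃ₙ⁻(σ^j x)`. -/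
def lamM {A : Type*} (X : Set (ℤ → A)) (F : (ℤ → A) → (ℤ → A)) (n : ℕ)
    (x : ℤ → A) : ℕ :=
  sSup (Set.range fun j : ℤ => lamTildeM X F n (shiftIter j x))

/-- `Iₙ⁺(x) = min{s ≥ 0 : F^i(W_{-s}⁺(x)) ⊆ W₀⁺(F^i(x)) for all 1 ≤ i ≤ n}`. -/
def Iplus {A : Type*} (X : Set (ℤ → A)) (F : (ℤ → A) → (ℤ → A)) (n : ℕ)
    (x : ℤ → A) : ℕ :=
  sInf {s : ℕ | ∀ i : ℕ, 1 ≤ i → i ≤ n →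
    F^[i] '' Wplus X (-(s : ℤ)) x ⊆ Wplus X 0 (F^[i] x)}

/-- `Iₙ⁻(x) = min{s ≥ 0 : F^i(W_s⁻(x)) ⊆ W₀⁻(F^i(x)) for all 1 ≤ i ≤ n}`. -/
def Iminus {A : Type*} (X : Set (ℤ → A)) (F : (ℤ → A) → (ℤ → A)) (n : ℕ)
    (x : ℤ → A) : ℕ :=
  sInf {s : ℕ | ∀ i : ℕ, 1 ≤ i → i ≤ n →
    F^[i] '' Wminus X (s : ℤ) x ⊆ Wminus X 0 (F^[i] x)}

/-- Average Lyapunov exponent `I_μ⁺ = liminf_n (∫ Iₙ⁺ dμ) / n`. -/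
def avgIplus {A : Type*} [MeasurableSpace A] (X : Set (ℤ → A))
    (F : (ℤ → A) → (ℤ → A)) (μ : Measure (ℤ → A)) : ℝ :=
  Filter.liminf (fun n : ℕ => (∫ x, (Iplus X F n x : ℝ) ∂μ) / n) Filter.atTop

/-- Average Lyapunov exponent `I_μ⁻ = liminf_n (∫ Iₙ⁻ dμ) / n`. -/
def avgIminus {A : Type*} [MeasurableSpace A] (X : Set (ℤ → A))
    (F : (ℤ → A) → (ℤ → A)) (μ : Measure (ℤ → A)) : ℝ :=
  Filter.liminf (fun n : ℕ => (∫ x, (Iminus X F n x : ℝ) ∂μ) / n) Filter.atTop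

/-- The topological support `S(μ)` of a measure `μ` on `ℤ → A`. -/
def msupp {A : Type*} [TopologicalSpace A] [MeasurableSpace A]
    (μ : Measure (ℤ → A)) : Set (ℤ → A) :=
  {x | ∀ U : Set (ℤ → A), IsOpen U → x ∈ U → 0 < μ U}

/-- `x` is an equicontinuous point of `F` on `X`: for every `ε = 2^{-m}` there is a
`δ = 2^{-k}` such that points of `X` agreeing with `x` on coordinates `|j| ≤ k`
have all their `F`-iterates agreeing with those of `x` on coordinates `|j| ≤ m`. -/
def IsEquicontPt {A : Type*} (X : Set (ℤ → A)) (F : (ℤ → A) → (ℤ → A))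
    (x : ℤ → A) : Prop :=
  ∀ m : ℕ, ∃ k : ℕ, ∀ y ∈ X, (∀ j : ℤ, |j| ≤ (k : ℤ) → y j = x j) →
    ∀ n : ℕ, ∀ j : ℤ, |j| ≤ (m : ℤ) → F^[n] y j = F^[n] x j

/-- Entropy `H_μ(α) = ∑ -μ(A) log μ(A)` of the finite partition given by the
fibers of `α`. -/
def partEnt {Ω : Type*} [MeasurableSpace Ω] (μ : Measure Ω) {I : Type*} [Fintype I]
    (α : Ω → I) : ℝ :=
  ∑ i : I, Real.negMulLog (μ (α ⁻¹' {i})).toReal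

/-- Metric entropy `h_μ(T, α)` of `T` relative to the finite partition `α`
(the limit of the subadditive sequence `H_μ(α ∨ T⁻¹α ∨ … ∨ T^{-n}α)/(n+1)`
equals its infimum). -/
def entropyPart {Ω : Type*} [MeasurableSpace Ω] (μ : Measure Ω) (T : Ω → Ω)
    {k : ℕ} (α : Ω → Fin k) : ℝ :=
  ⨅ n : ℕ, partEnt μ (fun x (i : Fin (n + 1)) => α (T^[(i : ℕ)] x)) / (n + 1)

/-- Kolmogorov–Sinai metric entropy `h_μ(T)`: supremum of `h_μ(T, α)` over all
finite measurable partitions `α`. -/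
def metricEntropy {Ω : Type*} [MeasurableSpace Ω] (μ : Measure Ω) (T : Ω → Ω) : ℝ :=
  ⨆ p : {q : Σ k : ℕ, Ω → Fin k // Measurable q.2}, entropyPart μ T p.1.2

/-- `B ∈ A^{2k+1}` is a blocking word for `F` (with radius `r`): there are `i` with
`2i+1 ≥ r` and words `vₙ ∈ A^{2i+1}`, independent of `x`, such that every `x ∈ X`
with `x(-k,k) = B` satisfies `F^n(x)(-i,i) = vₙ` for all `n ≥ 1`. -/
def IsBlockingWord {A : Type*} (X : Set (ℤ → A)) (F : (ℤ → A) → (ℤ → A)) (r k : ℕ)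
    (B : Fin (2 * k + 1) → A) : Prop :=
  ∃ i : ℕ, r ≤ 2 * i + 1 ∧ ∃ v : ℕ → Fin (2 * i + 1) → A,
    ∀ x ∈ X, (∀ j : Fin (2 * k + 1), x (((j : ℕ) : ℤ) - (k : ℤ)) = B j) →
      ∀ n : ℕ, 1 ≤ n → ∀ j : Fin (2 * i + 1),
        F^[n] x (((j : ℕ) : ℤ) - (i : ℤ)) = v n j

/-- `D(n, 2^{-p})`: minimal cardinality of an `(n, 2^{-p})`-covering (spanning) set
for `F`, where closeness in the Bowen metric `d_n` up to `2^{-p}` means agreement of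
all iterates `F^i`, `i ≤ n`, on the coordinates `|j| ≤ p`. -/
def coverNum {A : Type*} (F : (ℤ → A) → (ℤ → A)) (n p : ℕ) : ℕ :=
  sInf {N : ℕ | ∃ S : Finset (ℤ → A), S.card ≤ N ∧ ∀ x : ℤ → A, ∃ y ∈ S,
    ∀ i : ℕ, i ≤ n → ∀ j : ℤ, |j| ≤ (p : ℤ) → F^[i] x j = F^[i] y j}

/-- Topological entropy `h_top(F) = lim_{ε→0} lim_n (1/n) log D(n, ε)`. -/
def htop {A : Type*} (F : (ℤ → A) → (ℤ → A)) : ℝ :=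
  ⨆ p : ℕ, Filter.limsup (fun n : ℕ => Real.log (coverNum F n p) / n) Filter.atTop

end

section Entropy

open Real

variable {Ω I J : Type*} [MeasurableSpace Ω] {μ : Measure Ω} [IsProbabilityMeasure μ]

lemma negMulLog_sum_le {ι : Type*} (s : Finset ι) (p : ι → ℝ) (hp : ∀ i ∈ s, 0 ≤ p i) :
    negMulLog (∑ i ∈ s, p i) ≤ ∑ i ∈ s, negMulLog (p i) := by
  simp only [negMulLog]
  rw [← Finset.sum_neg_distrib, Finset.sum_mul]
  refine Finset.sum_le_sum fun i hi => ?_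
  rcases (hp i hi).eq_or_lt with h0 | h0
  · simp [← h0]
  · have := Real.log_le_log h0 (Finset.single_le_sum hp hi)
    nlinarith

lemma partEnt_nonneg [Fintype I] (α : Ω → I) : 0 ≤ partEnt μ α :=
  Finset.sum_nonneg fun _ _ => negMulLog_nonneg ENNReal.toReal_nonneg measureReal_le_one

/-- Entropy does not increase when passing to a coarser partition. -/
lemma partEnt_le_of_factorsThrough [Fintype I] [Fintype J] {α : Ω → I} {β : Ω → J}
    (hβ : ∀ j, MeasurableSet (β ⁻¹' {j})) (h : ∀ x y, β x = β y → α x = α y) :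
    partEnt μ α ≤ partEnt μ β := by
  classical
  have : Nonempty Ω := nonempty_of_isProbabilityMeasure μ
  have : Nonempty I := this.map α
  obtain ⟨f, rfl⟩ := (Function.factorsThrough_iff (f := β) α).1 fun x y hxy => h x y hxy
  unfold partEnt
  rw [← Finset.sum_fiberwise Finset.univ f]
  refine Finset.sum_le_sum fun i _ => ?_
  have key : (μ ((f ∘ β) ⁻¹' {i})).toReal
      = ∑ j with f j = i, (μ (β ⁻¹' {j})).toReal := by
    have := sum_measureReal_preimage_singleton (μ := μ) (Finset.univ.filter fun j => f j = i)
      (f := β) (fun j _ => hβ j)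
    simp only [measureReal_def] at this
    rw [this]
    congr 2
    ext x
    simp
  rw [key]
  exact negMulLog_sum_le _ _ fun _ _ => ENNReal.toReal_nonneg

lemma negMulLog_le_of_le {p a b : ℝ} (hp : 0 ≤ p) (ha : p ≤ a) (hb : p ≤ b) :
    negMulLog p ≤ -(p * log a) - p * log b + a * b - p := by
  rcases hp.eq_or_lt with rfl | h0
  · simpa using mul_nonneg ha hb
  · have ha' := h0.trans_le ha
    have hb' := h0.trans_le hb
    have h1 := Real.log_le_sub_one_of_pos (show 0 < a * b / p by positivity)
    rw [Real.log_div (by positivity) h0.ne', Real.log_mul ha'.ne' hb'.ne'] at h1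
    have h2 := mul_le_mul_of_nonneg_left h1 hp
    have h3 : p * (a * b / p - 1) = a * b - p := by field_simp
    rw [h3] at h2
    simp only [negMulLog]
    linarith

/-- Subadditivity of the entropy of partitions. -/
lemma partEnt_prod_le [Fintype I] [Fintype J] {α : Ω → I} {β : Ω → J}
    (hα : ∀ i, MeasurableSet (α ⁻¹' {i})) (hβ : ∀ j, MeasurableSet (β ⁻¹' {j})) :
    partEnt μ (fun x => (α x, β x)) ≤ partEnt μ α + partEnt μ β := by
  classical
  set p : I → J → ℝ := fun i j => μ.real (α ⁻¹' {i} ∩ β ⁻¹' {j}) with hp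
  have hfst : ∀ i, ∑ j, p i j = μ.real (α ⁻¹' {i}) := fun i => by
    have := sum_measureReal_preimage_singleton (μ := μ.restrict (α ⁻¹' {i})) Finset.univ
      (f := β) (fun j _ => hβ j)
    simpa [measureReal_restrict_apply, hβ, hp, inter_comm] using this
  have hsnd : ∀ j, ∑ i, p i j = μ.real (β ⁻¹' {j}) := fun j => by
    have := sum_measureReal_preimage_singleton (μ := μ.restrict (β ⁻¹' {j})) Finset.univ
      (f := α) (fun i _ => hα i)
    simpa [measureReal_restrict_apply, hα, hp] using this
  have hα1 : ∑ i, μ.real (α ⁻¹' {i}) = 1 := by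
    simpa using sum_measureReal_preimage_singleton (μ := μ) Finset.univ (f := α) fun i _ => hα i
  have hβ1 : ∑ j, μ.real (β ⁻¹' {j}) = 1 := by
    simpa using sum_measureReal_preimage_singleton (μ := μ) Finset.univ (f := β) fun j _ => hβ j
  have hprod : partEnt μ (fun x => (α x, β x)) = ∑ i, ∑ j, negMulLog (p i j) := by
    rw [partEnt, Fintype.sum_prod_type]
    refine Finset.sum_congr rfl fun i _ => Finset.sum_congr rfl fun j _ => ?_
    simp only [hp, measureReal_def]
    congr 3
    ext x
    simp
  have hle : ∀ i j, negMulLog (p i j) ≤ -(p i j * log (μ.real (α ⁻¹' {i})))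
      - p i j * log (μ.real (β ⁻¹' {j})) + μ.real (α ⁻¹' {i}) * μ.real (β ⁻¹' {j}) - p i j :=
    fun i j => negMulLog_le_of_le measureReal_nonneg (measureReal_mono inter_subset_left)
      (measureReal_mono inter_subset_right)
  rw [hprod]
  refine (Finset.sum_le_sum fun i _ => Finset.sum_le_sum fun j _ => hle i j).trans ?_
  have e1 : ∑ i, ∑ j, p i j * log (μ.real (α ⁻¹' {i})) = - partEnt μ α := by
    simp_rw [← Finset.sum_mul, hfst, partEnt, negMulLog, measureReal_def]
    simp
  have e2 : ∑ i, ∑ j, p i j * log (μ.real (β ⁻¹' {j})) = - partEnt μ β := by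
    rw [Finset.sum_comm]
    simp_rw [← Finset.sum_mul, hsnd, partEnt, negMulLog, measureReal_def]
    simp
  have e3 : ∑ i, ∑ j, μ.real (α ⁻¹' {i}) * μ.real (β ⁻¹' {j}) = 1 := by
    simp_rw [← Finset.mul_sum, hβ1, mul_one, hα1]
  have e4 : ∑ i, ∑ j, p i j = 1 := by simp_rw [hfst, hα1]
  simp only [Finset.sum_sub_distrib, Finset.sum_add_distrib, Finset.sum_neg_distrib, e1, e2, e3,
    e4]
  linarith

lemma measurableSet_preimage_pi_singleton {n : ℕ} {Z : Fin n → Ω → I}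
    (hZ : ∀ i c, MeasurableSet (Z i ⁻¹' {c})) (z : Fin n → I) :
    MeasurableSet ((fun x i => Z i x) ⁻¹' {z}) := by
  have : (fun x i => Z i x) ⁻¹' {z} = ⋂ i, Z i ⁻¹' {z i} := by
    ext x
    simp [funext_iff]
  rw [this]
  exact MeasurableSet.iInter fun i => hZ i _

lemma measurableSet_preimage_prod_singleton {α : Ω → I} {β : Ω → J}
    (hα : ∀ i, MeasurableSet (α ⁻¹' {i})) (hβ : ∀ j, MeasurableSet (β ⁻¹' {j})) (z : I × J) :
    MeasurableSet ((fun x => (α x, β x)) ⁻¹' {z}) := by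
  have : (fun x => (α x, β x)) ⁻¹' {z} = α ⁻¹' {z.1} ∩ β ⁻¹' {z.2} := by
    ext x
    simp [Prod.ext_iff]
  rw [this]
  exact (hα _).inter (hβ _)

lemma partEnt_pi_le [Fintype I] : ∀ {n : ℕ} {Z : Fin n → Ω → I}
    (_ : ∀ i c, MeasurableSet (Z i ⁻¹' {c})),
    partEnt μ (fun x i => Z i x) ≤ ∑ i, partEnt μ (Z i)
  | 0, Z, _ => by
    have : ∀ z : Fin 0 → I, (fun x i => Z i x) ⁻¹' {z} = univ := fun z => by
      ext x
      simp [Subsingleton.elim _ z]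
    simp [partEnt, this]
  | n + 1, Z, hZ => by
    have hpi := measurableSet_preimage_pi_singleton fun i : Fin n => hZ i.succ
    calc partEnt μ (fun x i => Z i x)
        ≤ partEnt μ (fun x => (Z 0 x, fun i : Fin n => Z i.succ x)) := by
          refine partEnt_le_of_factorsThrough
            (measurableSet_preimage_prod_singleton (hZ 0) hpi) fun x y hxy => ?_
          simp only [Prod.mk.injEq, funext_iff] at hxy
          exact funext fun i => Fin.cases hxy.1 hxy.2 i
      _ ≤ partEnt μ (Z 0) + partEnt μ (fun x (i : Fin n) => Z i.succ x) :=
          partEnt_prod_le (hZ 0) hpi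
      _ ≤ _ := by
          rw [Fin.sum_univ_succ]
          gcongr
          exact partEnt_pi_le fun i => hZ i.succ

/-- A partition into a bounded number of atoms, one of which has almost full measure, has small
entropy. -/
lemma exists_partEnt_option_le (μ : Measure Ω) [IsProbabilityMeasure μ] [Fintype I] {η : ℝ}
    (hη : 0 < η) : ∃ ε > 0, ∀ Z : Ω → Option I,
      (∀ c, MeasurableSet (Z ⁻¹' {c})) → μ.real (Z ⁻¹' {none})ᶜ ≤ ε → partEnt μ Z ≤ η := by
  set η' := η / (Fintype.card (Option I)) with hη'
  have hη'0 : 0 < η' := by positivity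
  have h0 := Metric.continuousAt_iff.1 (continuous_negMulLog.continuousAt (x := 0)) η' hη'0
  have h1 := Metric.continuousAt_iff.1 (continuous_negMulLog.continuousAt (x := 1)) η' hη'0
  obtain ⟨a, ha, h0⟩ := h0
  obtain ⟨b, hb, h1⟩ := h1
  refine ⟨min a b / 2, by positivity, fun Z hZ hle => ?_⟩
  have hlt : min a b / 2 < min a b := half_lt_self (lt_min ha hb)
  have hbound : ∀ c, negMulLog (μ (Z ⁻¹' {c})).toReal ≤ η' := by
    rintro (_ | c)
    · have : dist (μ (Z ⁻¹' {none})).toReal 1 < b := by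
        rw [probReal_compl_eq_one_sub (hZ none), measureReal_def] at hle
        rw [dist_comm, Real.dist_eq, abs_of_nonneg]
        · linarith [min_le_right a b]
        · exact sub_nonneg.2 measureReal_le_one
      have := h1 this
      rw [negMulLog_one, dist_zero_right] at this
      exact (le_abs_self _).trans this.le
    · have : dist (μ (Z ⁻¹' {some c})).toReal 0 < a := by
        have hsub : μ.real (Z ⁻¹' {some c}) ≤ μ.real (Z ⁻¹' {none})ᶜ :=
          measureReal_mono fun x hx => by simp_all
        rw [dist_zero_right, Real.norm_of_nonneg ENNReal.toReal_nonneg]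
        rw [measureReal_def] at hsub
        linarith [min_le_left a b]
      have := h0 this
      rw [negMulLog_zero, dist_zero_right] at this
      exact (le_abs_self _).trans this.le
  calc partEnt μ Z ≤ ∑ _c : Option I, η' := Finset.sum_le_sum fun c _ => hbound c
    _ = η := by
      rw [Finset.sum_const, Finset.card_univ, nsmul_eq_mul, hη']
      field_simp

/-- If, up to sets of small measure, a single finite partition determines at every time the atom
of `α` visited by the orbit, then the entropy relative to `α` vanishes. -/
lemma entropyPart_eq_zero {T : Ω → Ω} (hT : Measurable T) {k : ℕ} {α : Ω → Fin k}
    (hα : Measurable α)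
    (H : ∀ ε > 0, ∃ (J : Type*) (_ : Fintype J) (W : Ω → J) (D : ℕ → Set Ω),
      (∀ j, MeasurableSet (W ⁻¹' {j})) ∧ (∀ i, MeasurableSet (D i)) ∧
      (∀ i, μ.real (D i)ᶜ ≤ ε) ∧
      ∀ i, ∀ x ∈ D i, ∀ y ∈ D i, W x = W y → α (T^[i] x) = α (T^[i] y)) :
    entropyPart μ T α = 0 := by
  classical
  have hbdd : BddBelow (range fun n : ℕ =>
      partEnt μ (fun x (i : Fin (n + 1)) => α (T^[(i : ℕ)] x)) / (n + 1)) :=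
    ⟨0, by rintro _ ⟨n, rfl⟩; exact div_nonneg (partEnt_nonneg _) (by positivity)⟩
  refine le_antisymm (le_of_forall_pos_le_add fun η hη => ?_)
    (le_ciInf fun n => div_nonneg (partEnt_nonneg _) (by positivity))
  rw [zero_add]
  obtain ⟨ε, hε, hsmall⟩ := exists_partEnt_option_le μ (I := Fin k) hη
  obtain ⟨J, _, W, D, hW, hD, hDε, hdet⟩ := H ε hε
  set Z : ℕ → Ω → Option (Fin k) :=
    fun i x => if x ∈ D i then none else some (α (T^[i] x)) with hZdef
  have hZnone : ∀ i, Z i ⁻¹' {none} = D i := fun i => by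
    ext x
    simp [hZdef]
  have hZsome : ∀ i c, Z i ⁻¹' {some c} = (D i)ᶜ ∩ (α ∘ T^[i]) ⁻¹' {c} := fun i c => by
    ext x
    simp [hZdef]
  have hZm : ∀ i c, MeasurableSet (Z i ⁻¹' {c}) := by
    rintro i (_ | c)
    · rw [hZnone]
      exact hD i
    · rw [hZsome]
      exact (hD i).compl.inter ((hα.comp (hT.iterate i)) (measurableSet_singleton c))
  have hZη : ∀ i, partEnt μ (Z i) ≤ η := fun i =>
    hsmall _ (hZm i) (by rw [hZnone]; exact hDε i)
  have hbound : ∀ n : ℕ, entropyPart μ T α ≤ partEnt μ W / ((n : ℝ) + 1) + η := fun n => by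
    have h1 : partEnt μ (fun x (i : Fin (n + 1)) => α (T^[(i : ℕ)] x))
        ≤ partEnt μ W + (n + 1) * η := by
      have hpi := measurableSet_preimage_pi_singleton fun i : Fin (n + 1) => hZm i
      calc _ ≤ partEnt μ (fun x => (W x, fun i : Fin (n + 1) => Z i x)) := by
            refine partEnt_le_of_factorsThrough
              (measurableSet_preimage_prod_singleton hW hpi) fun x y hxy => funext fun i => ?_
            simp only [Prod.mk.injEq, funext_iff] at hxy
            have hi := hxy.2 i
            by_cases hx : x ∈ D i <;> by_cases hy : y ∈ D i <;> simp [hZdef, hx, hy] at hi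
            · exact hdet i x hx y hy hxy.1
            · exact hi
        _ ≤ _ := partEnt_prod_le hW hpi
        _ ≤ partEnt μ W + ∑ _i : Fin (n + 1), η := by
            gcongr
            exact (partEnt_pi_le fun i => hZm i).trans (Finset.sum_le_sum fun i _ => hZη i)
        _ = _ := by simp
    refine (ciInf_le hbdd n).trans ?_
    rw [div_add' _ _ _ (by positivity)]
    gcongr
    linarith
  have hlim : Tendsto (fun n : ℕ => partEnt μ W / ((n : ℝ) + 1) + η) atTop (𝓝 (0 + η)) :=
    (tendsto_const_nhds.div_atTop
      (tendsto_atTop_add_const_right _ _ tendsto_natCast_atTop_atTop)).add_const η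
  simpa using ge_of_tendsto' hlim hbound

end Entropy

lemma metricEntropy_eq_zero {Ω : Type*} [MeasurableSpace Ω] {μ : Measure Ω} {T : Ω → Ω}
    (h : ∀ (k : ℕ) (α : Ω → Fin k), Measurable α → entropyPart μ T α = 0) :
    metricEntropy μ T = 0 := by
  have : ∀ p : {q : Σ k : ℕ, Ω → Fin k // Measurable q.2}, entropyPart μ T p.1.2 = 0 :=
    fun p => h _ _ p.2
  simp [metricEntropy, this]

section Averages

variable {Ω : Type*} [MeasurableSpace Ω] {μ : Measure Ω} [IsProbabilityMeasure μ]

lemma exists_measureReal_compl_le {E : ℕ → Set Ω} (hE : ∀ N, MeasurableSet (E N))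
    (hmono : Monotone E) (hae : ∀ᵐ x ∂μ, ∃ N, x ∈ E N) {ε : ℝ} (hε : 0 < ε) :
    ∃ N, μ.real (E N)ᶜ ≤ ε := by
  have h1 := tendsto_measure_iInter_atTop (μ := μ) (s := fun N => (E N)ᶜ)
    (fun N => (hE N).compl.nullMeasurableSet) (fun a b hab => compl_subset_compl.2 (hmono hab))
    ⟨0, measure_ne_top _ _⟩
  have h2 : μ (⋂ N, (E N)ᶜ) = 0 := by
    rw [← compl_iUnion]
    simpa [ae_iff, compl_def] using hae
  rw [h2] at h1
  have h3 := (ENNReal.tendsto_toReal ENNReal.zero_ne_top).comp h1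
  obtain ⟨N, hN⟩ := (h3.eventually_le_const (by simpa using hε)).exists
  exact ⟨N, hN⟩

lemma liminf_integral_div_eq_zero {I : ℕ → Ω → ℕ} {r c : ℕ} {E : ℕ → Set Ω}
    (hE : ∀ N, MeasurableSet (E N)) (hmono : Monotone E) (hae : ∀ᵐ x ∂μ, ∃ N, x ∈ E N)
    (hlin : ∀ᵐ x ∂μ, ∀ n, I n x ≤ r * n)
    (hbdd : ∀ᵐ x ∂μ, ∀ N n, x ∈ E N → I n x ≤ N + c) :
    liminf (fun n : ℕ => (∫ x, (I n x : ℝ) ∂μ) / n) atTop = 0 := by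
  refine Tendsto.liminf_eq ?_
  have hbound : ∀ N n, ∫ x, (I n x : ℝ) ∂μ ≤ (N + c) + r * n * μ.real (E N)ᶜ := fun N n => by
    have hint : Integrable ((E N)ᶜ.indicator fun _ => (r * n : ℝ)) μ :=
      (integrable_const _).indicator (hE N).compl
    calc ∫ x, (I n x : ℝ) ∂μ
        ≤ ∫ x, ((N + c : ℝ) + (E N)ᶜ.indicator (fun _ => (r * n : ℝ)) x) ∂μ := by
          refine integral_mono_of_nonneg (ae_of_all _ fun x => by positivity)
            ((integrable_const _).add hint) ?_
          filter_upwards [hlin, hbdd] with x h1 h2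
          by_cases hx : x ∈ E N
          · simpa [hx] using (Nat.cast_le (α := ℝ)).2 (h2 N n hx)
          · have := (Nat.cast_le (α := ℝ)).2 (h1 n)
            push_cast at this
            simp only [mem_compl_iff, hx, not_false_eq_true, indicator_of_mem]
            have : (0 : ℝ) ≤ N + c := by positivity
            linarith
      _ = _ := by
          rw [integral_add (integrable_const _) hint, integral_indicator_const _ (hE N).compl]
          simp [mul_comm]
  rw [Metric.tendsto_atTop]
  intro ε hε
  obtain ⟨N, hN⟩ := exists_measureReal_compl_le (μ := μ) hE hmono hae
    (ε := ε / (2 * (r + 1))) (by positivity)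
  obtain ⟨n₀, hn₀⟩ := exists_nat_gt ((N + c : ℝ) / (ε / 2))
  refine ⟨n₀ + 1, fun n hn => ?_⟩
  have hn0 : (0 : ℝ) < n := by exact_mod_cast (Nat.succ_pos n₀).trans_le hn
  have hnn : (n₀ : ℝ) ≤ n := by exact_mod_cast (Nat.le_succ n₀).trans hn
  have h0 : 0 ≤ ∫ x, (I n x : ℝ) ∂μ := integral_nonneg fun x => by positivity
  rw [dist_zero_right, Real.norm_of_nonneg (by positivity), div_lt_iff₀ hn0]
  have h1 : (N + c : ℝ) < n * (ε / 2) := by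
    rw [div_lt_iff₀ (by positivity)] at hn₀
    exact hn₀.trans_le (by gcongr)
  have h2 : r * n * μ.real (E N)ᶜ ≤ n * (ε / 2) := by
    calc r * n * μ.real (E N)ᶜ ≤ (r + 1) * n * (ε / (2 * (r + 1))) := by gcongr; linarith
      _ = _ := by field_simp
  linarith [hbound N n]

end Averages

section Ergodicity

variable {Ω : Type*} [MeasurableSpace Ω] {μ : Measure Ω} [IsProbabilityMeasure μ]

/-- Almost every orbit of an ergodic map visits a given set of positive measure infinitely
often. -/
lemma Ergodic.ae_frequently_mem {T : Ω → Ω} (hT : Ergodic T μ) {C : Set Ω}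
    (hC : MeasurableSet C) (hpos : μ C ≠ 0) : ∀ᵐ x ∂μ, ∃ᶠ n in atTop, T^[n] x ∈ C := by
  set G : Set Ω := {x | ∃ᶠ n in atTop, T^[n] x ∈ C} with hG
  have hGm : MeasurableSet G := by
    have : G = ⋂ a : ℕ, ⋃ b : ℕ, ⋃ _ : a ≤ b, T^[b] ⁻¹' C := by
      ext x
      simp [hG, frequently_atTop]
    rw [this]
    exact MeasurableSet.iInter fun a => MeasurableSet.iUnion fun b => MeasurableSet.iUnion fun _ =>
      hT.measurable.iterate b hC
  have hinv : T ⁻¹' G = G := by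
    ext x
    simp only [hG, mem_preimage, mem_ofPred_eq, ← Function.iterate_succ_apply]
    conv_rhs => rw [← map_add_atTop_eq_nat 1, frequently_map]
  rcases hT.ae_mem_or_ae_notMem hGm hinv with h | h
  · exact h
  · have hrec := hT.toMeasurePreserving.conservative.ae_mem_imp_frequently_image_mem
      hC.nullMeasurableSet
    refine absurd (measure_eq_zero_iff_ae_notMem.2 ?_) hpos
    filter_upwards [h, hrec] with x h1 h2 h3
    exact h1 (h2 h3)

end Ergodicity

section Shift

variable {A : Type*}

@[simp]
lemma shiftIter_apply (j : ℤ) (x : ℤ → A) (i : ℤ) : shiftIter j x i = x (i + j) := rfl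

lemma shiftIter_shiftIter (i j : ℤ) (x : ℤ → A) :
    shiftIter i (shiftIter j x) = shiftIter (i + j) x := by
  ext n
  simp [add_assoc]

lemma iterate_shiftIter (j : ℤ) (n : ℕ) :
    (shiftIter j : (ℤ → A) → (ℤ → A))^[n] = shiftIter (n * j) := by
  induction n with
  | zero => ext; simp
  | succ n ih =>
    rw [Function.iterate_succ', ih]
    ext x i
    simp only [Function.comp_apply, shiftIter_apply]
    congr 1
    push_cast
    ring

lemma shiftMap_eq_shiftIter : shiftMap A = shiftIter 1 := rfl

lemma measurable_shiftIter [MeasurableSpace A] (j : ℤ) :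
    Measurable (shiftIter j : (ℤ → A) → (ℤ → A)) :=
  measurable_pi_lambda _ fun i => measurable_pi_apply (i + j)

/-- The shift as a measurable equivalence. -/
def shiftEquiv (A : Type*) [MeasurableSpace A] : (ℤ → A) ≃ᵐ (ℤ → A) where
  toFun := shiftMap A
  invFun := shiftIter (-1)
  left_inv x := by ext; simp [shiftMap]
  right_inv x := by ext; simp [shiftMap]
  measurable_toFun := measurable_shiftIter 1
  measurable_invFun := measurable_shiftIter (-1)

lemma ergodic_shiftIter_neg_one [MeasurableSpace A] {μ : Measure (ℤ → A)}
    (h : Ergodic (shiftMap A) μ) : Ergodic (shiftIter (-1)) μ :=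
  Ergodic.symm (e := shiftEquiv A) h

lemma shiftIter_mem {X : Set (ℤ → A)} (hX : shiftMap A '' X = X) {x : ℤ → A} (hx : x ∈ X)
    (j : ℤ) : shiftIter j x ∈ X := by
  have hpos : ∀ y ∈ X, shiftIter 1 y ∈ X := fun y hy => hX ▸ mem_image_of_mem _ hy
  have hneg : ∀ y ∈ X, shiftIter (-1) y ∈ X := fun y hy => by
    rw [← hX] at hy
    obtain ⟨z, hz, rfl⟩ := hy
    rw [shiftMap_eq_shiftIter, shiftIter_shiftIter]
    convert hz using 1
    ext i
    simp
  induction j with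
  | zero => convert hx using 1; ext; simp
  | succ n ih =>
    rw [add_comm, ← shiftIter_shiftIter]
    exact hpos _ ih
  | pred n ih =>
    rw [sub_eq_add_neg, add_comm, ← shiftIter_shiftIter]
    exact hneg _ ih

end Shift

section LocalRule

variable {A : Type*} {F : (ℤ → A) → (ℤ → A)} {r : ℕ}

lemma HasLocalRule.apply_congr (h : HasLocalRule F r) {x y : ℤ → A} {i : ℤ}
    (hxy : ∀ j, |j - i| ≤ r → x j = y j) : F x i = F y i := by
  obtain ⟨f, hf⟩ := h
  rw [hf, hf]
  congr 1
  ext j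
  have := j.2
  exact hxy _ (abs_le.2 (by omega))

lemma HasLocalRule.map_shiftIter (h : HasLocalRule F r) (q : ℤ) (x : ℤ → A) :
    F (shiftIter q x) = shiftIter q (F x) := by
  obtain ⟨f, hf⟩ := h
  ext i
  rw [hf, shiftIter_apply, hf]
  congr 1
  ext j
  rw [shiftIter_apply]
  congr 1
  ring

lemma HasLocalRule.iterate_shiftIter (h : HasLocalRule F r) (q : ℤ) (n : ℕ) (x : ℤ → A) :
    F^[n] (shiftIter q x) = shiftIter q (F^[n] x) :=
  Function.Commute.iterate_left (h.map_shiftIter q) n x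

/-- If two orbits agree at all times on `B`, and every other cell of `D` has its neighbourhood
in `D`, then initial agreement on `D` propagates. -/
lemma HasLocalRule.iterate_eqOn (h : HasLocalRule F r) {x y : ℤ → A} {B D : Set ℤ}
    (h0 : EqOn x y D) (hB : ∀ n, EqOn (F^[n] x) (F^[n] y) B)
    (hD : ∀ i ∈ D, i ∉ B → ∀ j, |j - i| ≤ r → j ∈ D) (n : ℕ) :
    EqOn (F^[n] x) (F^[n] y) D := by
  induction n with
  | zero => exact h0
  | succ n ih =>
    intro i hi
    by_cases hiB : i ∈ B
    · exact hB _ hiB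
    · rw [Function.iterate_succ_apply', Function.iterate_succ_apply']
      exact h.apply_congr fun j hj => ih (hD i hi hiB j hj)

lemma HasLocalRule.iterate_apply_congr (h : HasLocalRule F r) (n : ℕ) {x y : ℤ → A} {i : ℤ}
    (hxy : ∀ j, |j - i| ≤ r * n → x j = y j) : F^[n] x i = F^[n] y i := by
  induction n generalizing i with
  | zero => exact hxy i (by simp)
  | succ n ih =>
    rw [Function.iterate_succ_apply', Function.iterate_succ_apply']
    refine h.apply_congr fun j hj => ih fun l hl => hxy l ?_
    calc |l - i| ≤ |l - j| + |j - i| := abs_sub_le l j i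
      _ ≤ r * n + r := add_le_add hl hj
      _ = _ := by push_cast; ring

end LocalRule

section Blocking

variable {A : Type*}

/-- The points agreeing with `x₀` on the coordinates `|j| ≤ k`. -/
def centralCylinder (x₀ : ℤ → A) (k : ℕ) : Set (ℤ → A) := {x | ∀ j : ℤ, |j| ≤ k → x j = x₀ j}

lemma centralCylinder_eq_pi (x₀ : ℤ → A) (k : ℕ) :
    centralCylinder x₀ k = (Icc (-k : ℤ) k).pi fun j => {x₀ j} := by
  ext x
  simp [centralCylinder, Set.mem_pi, abs_le]

lemma isOpen_centralCylinder [TopologicalSpace A] [DiscreteTopology A] (x₀ : ℤ → A) (k : ℕ) :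
    IsOpen (centralCylinder x₀ k) := by
  rw [centralCylinder_eq_pi]
  exact isOpen_set_pi (finite_Icc _ _) fun _ _ => isOpen_discrete _

lemma measurableSet_centralCylinder [MeasurableSpace A] [MeasurableSingletonClass A]
    (x₀ : ℤ → A) (k : ℕ) : MeasurableSet (centralCylinder x₀ k) := by
  rw [centralCylinder_eq_pi]
  exact MeasurableSet.pi (finite_Icc _ _).countable fun _ _ => measurableSet_singleton _

/-- The points having an occurrence of the cylinder `C` at a position in `[-N, -p]`. -/
def visitsLeft (C : Set (ℤ → A)) (p N : ℕ) : Set (ℤ → A) :=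
  {x | ∃ j : ℕ, p ≤ j ∧ j ≤ N ∧ shiftIter (-j) x ∈ C}

/-- The points having an occurrence of the cylinder `C` at a position in `[p, N]`. -/
def visitsRight (C : Set (ℤ → A)) (p N : ℕ) : Set (ℤ → A) :=
  {x | ∃ j : ℕ, p ≤ j ∧ j ≤ N ∧ shiftIter j x ∈ C}

lemma visitsLeft_mono (C : Set (ℤ → A)) (p : ℕ) : Monotone (visitsLeft C p) :=
  fun _ _ h _ ⟨j, h1, h2, h3⟩ => ⟨j, h1, h2.trans h, h3⟩

lemma visitsRight_mono (C : Set (ℤ → A)) (p : ℕ) : Monotone (visitsRight C p) :=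
  fun _ _ h _ ⟨j, h1, h2, h3⟩ => ⟨j, h1, h2.trans h, h3⟩

variable [MeasurableSpace A]

lemma measurableSet_visitsLeft {C : Set (ℤ → A)} (hC : MeasurableSet C) (p N : ℕ) :
    MeasurableSet (visitsLeft C p N) := by
  have : visitsLeft C p N
      = ⋃ j : ℕ, ⋃ _ : p ≤ j, ⋃ _ : j ≤ N, shiftIter (-(j : ℤ)) ⁻¹' C := by
    ext x
    simp [visitsLeft, and_left_comm]
  rw [this]
  exact MeasurableSet.iUnion fun j => MeasurableSet.iUnion fun _ => MeasurableSet.iUnion fun _ =>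
    measurable_shiftIter _ hC

lemma measurableSet_visitsRight {C : Set (ℤ → A)} (hC : MeasurableSet C) (p N : ℕ) :
    MeasurableSet (visitsRight C p N) := by
  have : visitsRight C p N = ⋃ j : ℕ, ⋃ _ : p ≤ j, ⋃ _ : j ≤ N, shiftIter (j : ℤ) ⁻¹' C := by
    ext x
    simp [visitsRight, and_left_comm]
  rw [this]
  exact MeasurableSet.iUnion fun j => MeasurableSet.iUnion fun _ => MeasurableSet.iUnion fun _ =>
    measurable_shiftIter _ hC

variable {μ : Measure (ℤ → A)} [IsProbabilityMeasure μ]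

lemma ae_exists_mem_visitsLeft (herg : Ergodic (shiftMap A) μ) {C : Set (ℤ → A)}
    (hC : MeasurableSet C) (hpos : μ C ≠ 0) (p : ℕ) : ∀ᵐ x ∂μ, ∃ N, x ∈ visitsLeft C p N := by
  filter_upwards [(ergodic_shiftIter_neg_one herg).ae_frequently_mem hC hpos] with x hx
  obtain ⟨j, hj, hmem⟩ := frequently_atTop.1 hx p
  rw [iterate_shiftIter, mul_neg_one] at hmem
  exact ⟨j, j, hj, le_rfl, hmem⟩

lemma ae_exists_mem_visitsRight (herg : Ergodic (shiftMap A) μ) {C : Set (ℤ → A)}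
    (hC : MeasurableSet C) (hpos : μ C ≠ 0) (p : ℕ) : ∀ᵐ x ∂μ, ∃ N, x ∈ visitsRight C p N := by
  filter_upwards [herg.ae_frequently_mem hC hpos] with x hx
  obtain ⟨j, hj, hmem⟩ := frequently_atTop.1 hx p
  rw [shiftMap_eq_shiftIter, iterate_shiftIter, mul_one] at hmem
  exact ⟨j, j, hj, le_rfl, hmem⟩

end Blocking

section Approximation

variable {A : Type*}

lemma measure_compl_eq_zero_of_msupp_subset [TopologicalSpace A] [SecondCountableTopology A]
    [MeasurableSpace A] {μ : Measure (ℤ → A)} {X : Set (ℤ → A)} (h : msupp μ ⊆ X) :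
    μ Xᶜ = 0 := by
  refine measure_null_of_locally_null _ fun x hx => ?_
  have hx' : x ∉ msupp μ := fun h' => hx (h h')
  simp only [msupp, mem_ofPred_eq, not_forall, not_lt, nonpos_iff_eq_zero] at hx'
  obtain ⟨U, hU, hxU, h0⟩ := hx'
  exact ⟨U, mem_nhdsWithin_of_mem_nhds (hU.mem_nhds hxU), h0⟩

/-- Finite measurable partitions are approximated by partitions into cylinders. -/
lemma exists_measurableSet_determined [MeasurableSpace A] (μ : Measure (ℤ → A))
    [IsProbabilityMeasure μ] {k : ℕ} {α : (ℤ → A) → Fin k} (hα : Measurable α) {ε : ℝ}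
    (hε : 0 < ε) :
    ∃ (p : ℕ) (G : Set (ℤ → A)), MeasurableSet G ∧ μ.real Gᶜ ≤ ε ∧
      ∀ x ∈ G, ∀ y ∈ G, (∀ j : ℤ, |j| ≤ p → x j = y j) → α x = α y := by
  have hε' : 0 < ENNReal.ofReal (ε / (k + 1)) := ENNReal.ofReal_pos.2 (by positivity)
  have happrox : ∀ c : Fin k, ∃ t ∈ measurableCylinders fun _ : ℤ => A,
      μ (symmDiff t (α ⁻¹' {c})) < ENNReal.ofReal (ε / (k + 1)) := fun c =>
    exists_measure_symmDiff_lt_of_generateFrom_isSetRing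
      isSetAlgebra_measurableCylinders.isSetRing
      ⟨{univ}, countable_singleton _,
        singleton_subset_iff.2 (univ_mem_measurableCylinders _), by simp⟩
      generateFrom_measurableCylinders.symm (hα (measurableSet_singleton c)) hε'
  choose t ht htμ using happrox
  simp only [mem_measurableCylinders] at ht
  choose s S hS hts using ht
  obtain ⟨p, hp⟩ : ∃ p : ℕ, ∀ c, ∀ j ∈ s c, |j| ≤ (p : ℤ) := by
    refine ⟨(Finset.univ.biUnion s).sup Int.natAbs, fun c j hj => ?_⟩
    rw [Int.abs_eq_natAbs]
    exact_mod_cast Finset.le_sup (f := Int.natAbs)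
      (Finset.mem_biUnion.2 ⟨c, Finset.mem_univ _, hj⟩)
  have htm : ∀ c, MeasurableSet (t c) := fun c =>
    MeasurableSet.of_mem_measurableCylinders ((mem_measurableCylinders _).2 ⟨s c, S c, hS c, hts c⟩)
  refine ⟨p, (⋃ c, symmDiff (t c) (α ⁻¹' {c}))ᶜ, (MeasurableSet.iUnion fun c =>
    (htm c).symmDiff (hα (measurableSet_singleton c))).compl, ?_, fun x hx y hy hxy => ?_⟩
  · rw [compl_compl]
    calc μ.real (⋃ c, symmDiff (t c) (α ⁻¹' {c}))
        ≤ ∑ c, μ.real (symmDiff (t c) (α ⁻¹' {c})) := measureReal_iUnion_fintype_le _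
      _ ≤ ∑ _c : Fin k, ε / (k + 1) := by
          refine Finset.sum_le_sum fun c _ => ?_
          exact ENNReal.toReal_le_of_le_ofReal (by positivity) (htμ c).le
      _ ≤ ε := by
          rw [Finset.sum_const, Finset.card_univ, Fintype.card_fin, nsmul_eq_mul, mul_div_assoc',
            div_le_iff₀ (by positivity)]
          nlinarith
  · have hmem : ∀ z ∈ (⋃ c, symmDiff (t c) (α ⁻¹' {c}))ᶜ, ∀ c, z ∈ t c ↔ α z = c := by
      intro z hz c
      simp only [mem_compl_iff, mem_iUnion, not_exists, mem_symmDiff, mem_preimage,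
        mem_singleton_iff] at hz
      have := hz c
      tauto
    have hxt : x ∈ t (α x) := (hmem x hx _).2 rfl
    refine ((hmem y hy _).1 ?_).symm
    have hres : (s (α x)).restrict y = (s (α x)).restrict x :=
      funext fun j => (hxy j (hp _ _ j.2)).symm
    rw [hts, mem_cylinder] at hxt ⊢
    rwa [hres]

end Approximation

section Propagation

variable {A : Type*} {X : Set (ℤ → A)} {F : (ℤ → A) → (ℤ → A)} {r k : ℕ} {x₀ x y : ℤ → A}

/-- The central cylinder around `x₀` of radius `k` blocks the propagation of information: it
determines all iterates of `F` on the coordinates `|j| ≤ r`. -/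
def IsBlockingCylinder (X : Set (ℤ → A)) (F : (ℤ → A) → (ℤ → A)) (r k : ℕ) (x₀ : ℤ → A) : Prop :=
  ∀ y ∈ X, y ∈ centralCylinder x₀ k → ∀ n : ℕ, ∀ j : ℤ, |j| ≤ r → F^[n] y j = F^[n] x₀ j

lemma IsBlockingCylinder.iterate_eq (hB : IsBlockingCylinder X F r k x₀) (hF : HasLocalRule F r)
    (hXσ : shiftMap A '' X = X) (hx : x ∈ X) (hy : y ∈ X) {q : ℤ}
    (hxq : shiftIter q x ∈ centralCylinder x₀ k) (hyq : shiftIter q y ∈ centralCylinder x₀ k)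
    (n : ℕ) {j : ℤ} (hj : |j - q| ≤ r) : F^[n] x j = F^[n] y j := by
  have h1 := hB _ (shiftIter_mem hXσ hx q) hxq n (j - q) hj
  have h2 := hB _ (shiftIter_mem hXσ hy q) hyq n (j - q) hj
  rw [hF.iterate_shiftIter, shiftIter_apply, sub_add_cancel] at h1 h2
  rw [h1, h2]

lemma shiftIter_mem_centralCylinder_congr {q : ℤ} (hxq : shiftIter q x ∈ centralCylinder x₀ k)
    (h : ∀ i, |i - q| ≤ k → y i = x i) : shiftIter q y ∈ centralCylinder x₀ k := fun j hj => by
  rw [← hxq j hj]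
  exact h _ (by simpa using hj)

lemma IsBlockingCylinder.eqOn_Ici (hB : IsBlockingCylinder X F r k x₀) (hF : HasLocalRule F r)
    (hXσ : shiftMap A '' X = X) (hx : x ∈ X) (hy : y ∈ X) {q : ℤ}
    (hxq : shiftIter q x ∈ centralCylinder x₀ k) (h : ∀ i, q - k ≤ i → y i = x i) (n : ℕ) :
    EqOn (F^[n] y) (F^[n] x) (Ici (q - r)) := by
  have hyq := shiftIter_mem_centralCylinder_congr hxq fun i hi => h i (by grind)
  have hblock : ∀ n, EqOn (F^[n] y) (F^[n] x) (Icc (q - r) (q + r)) := fun n j hj =>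
    hB.iterate_eq hF hXσ hy hx hyq hxq n (by grind)
  refine hF.iterate_eqOn (fun i hi => ?_) hblock (fun i hi hiB j hj => by grind) n
  by_cases hiB : i ∈ Icc (q - r) (q + r)
  · exact hblock 0 hiB
  · exact h i (by grind)

lemma IsBlockingCylinder.eqOn_Iic (hB : IsBlockingCylinder X F r k x₀) (hF : HasLocalRule F r)
    (hXσ : shiftMap A '' X = X) (hx : x ∈ X) (hy : y ∈ X) {q : ℤ}
    (hxq : shiftIter q x ∈ centralCylinder x₀ k) (h : ∀ i, i ≤ q + k → y i = x i) (n : ℕ) :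
    EqOn (F^[n] y) (F^[n] x) (Iic (q + r)) := by
  have hyq := shiftIter_mem_centralCylinder_congr hxq fun i hi => h i (by grind)
  have hblock : ∀ n, EqOn (F^[n] y) (F^[n] x) (Icc (q - r) (q + r)) := fun n j hj =>
    hB.iterate_eq hF hXσ hy hx hyq hxq n (by grind)
  refine hF.iterate_eqOn (fun i hi => ?_) hblock (fun i hi hiB j hj => by grind) n
  by_cases hiB : i ∈ Icc (q - r) (q + r)
  · exact hblock 0 hiB
  · exact h i (by grind)

lemma IsBlockingCylinder.eqOn_Icc (hB : IsBlockingCylinder X F r k x₀) (hF : HasLocalRule F r)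
    (hXσ : shiftMap A '' X = X) (hx : x ∈ X) (hy : y ∈ X) {q q' : ℤ} (hqq' : q ≤ q')
    (hxq : shiftIter q x ∈ centralCylinder x₀ k) (hxq' : shiftIter q' x ∈ centralCylinder x₀ k)
    (h : ∀ i, q - k ≤ i → i ≤ q' + k → y i = x i) (n : ℕ) :
    EqOn (F^[n] y) (F^[n] x) (Icc (q - r) (q' + r)) := by
  have hyq := shiftIter_mem_centralCylinder_congr hxq fun i hi => h i (by grind) (by grind)
  have hyq' := shiftIter_mem_centralCylinder_congr hxq' fun i hi => h i (by grind) (by grind)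
  have hblock : ∀ n, EqOn (F^[n] y) (F^[n] x)
      (Icc (q - r) (q + r) ∪ Icc (q' - r) (q' + r)) := by
    rintro n j (hj | hj)
    · exact hB.iterate_eq hF hXσ hy hx hyq hxq n (by grind)
    · exact hB.iterate_eq hF hXσ hy hx hyq' hxq' n (by grind)
  refine hF.iterate_eqOn (fun i hi => ?_) hblock (fun i hi hiB j hj => by grind) n
  by_cases hiB : i ∈ Icc (q - r) (q + r) ∪ Icc (q' - r) (q' + r)
  · exact hblock 0 hiB
  · exact h i (by grind) (by grind)

lemma Iplus_le_mul (hF : HasLocalRule F r) (hFX : MapsTo F X X) (n : ℕ) (x : ℤ → A) :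
    Iplus X F n x ≤ r * n := by
  refine Nat.sInf_le fun i _ hin => ?_
  rintro _ ⟨y, ⟨hyX, hy⟩, rfl⟩
  refine ⟨hFX.iterate i hyX, fun j hj => hF.iterate_apply_congr i fun l hl => hy l ?_⟩
  have : (r * i : ℤ) ≤ r * n := by gcongr
  push_cast
  grind

lemma Iminus_le_mul (hF : HasLocalRule F r) (hFX : MapsTo F X X) (n : ℕ) (x : ℤ → A) :
    Iminus X F n x ≤ r * n := by
  refine Nat.sInf_le fun i _ hin => ?_
  rintro _ ⟨y, ⟨hyX, hy⟩, rfl⟩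
  refine ⟨hFX.iterate i hyX, fun j hj => hF.iterate_apply_congr i fun l hl => hy l ?_⟩
  have : (r * i : ℤ) ≤ r * n := by gcongr
  push_cast
  grind

lemma IsBlockingCylinder.Iplus_le (hB : IsBlockingCylinder X F r k x₀) (hF : HasLocalRule F r)
    (hXσ : shiftMap A '' X = X) (hFX : MapsTo F X X) (hx : x ∈ X) {N : ℕ}
    (hxN : x ∈ visitsLeft (centralCylinder x₀ k) 0 N) (n : ℕ) : Iplus X F n x ≤ N + k := by
  obtain ⟨q, -, hqN, hxq⟩ := hxN
  refine Nat.sInf_le fun i _ _ => ?_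
  rintro _ ⟨y, ⟨hyX, hy⟩, rfl⟩
  refine ⟨hFX.iterate i hyX, fun j hj => ?_⟩
  exact hB.eqOn_Ici hF hXσ hx hyX hxq (fun l hl => hy l (by push_cast; omega)) i
    (mem_Ici.2 (by omega))

lemma IsBlockingCylinder.Iminus_le (hB : IsBlockingCylinder X F r k x₀) (hF : HasLocalRule F r)
    (hXσ : shiftMap A '' X = X) (hFX : MapsTo F X X) (hx : x ∈ X) {N : ℕ}
    (hxN : x ∈ visitsRight (centralCylinder x₀ k) 0 N) (n : ℕ) : Iminus X F n x ≤ N + k := by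
  obtain ⟨q, -, hqN, hxq⟩ := hxN
  refine Nat.sInf_le fun i _ _ => ?_
  rintro _ ⟨y, ⟨hyX, hy⟩, rfl⟩
  refine ⟨hFX.iterate i hyX, fun j hj => ?_⟩
  exact hB.eqOn_Iic hF hXσ hx hyX hxq (fun l hl => hy l (by push_cast; omega)) i
    (mem_Iic.2 (by omega))

lemma IsBlockingCylinder.iterate_eq_of_visits (hB : IsBlockingCylinder X F r k x₀)
    (hF : HasLocalRule F r) (hXσ : shiftMap A '' X = X) (hx : x ∈ X) (hy : y ∈ X) {p N : ℕ}
    (hxl : x ∈ visitsLeft (centralCylinder x₀ k) p N)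
    (hxr : x ∈ visitsRight (centralCylinder x₀ k) p N)
    (h : ∀ i ∈ Finset.Icc (-(N + k) : ℤ) (N + k), x i = y i) (n : ℕ) {j : ℤ} (hj : |j| ≤ p) :
    F^[n] x j = F^[n] y j := by
  obtain ⟨q, hpq, hqN, hxq⟩ := hxl
  obtain ⟨q', hpq', hqN', hxq'⟩ := hxr
  rw [abs_le] at hj
  refine (hB.eqOn_Icc hF hXσ hx hy (by omega) hxq hxq' (fun i h1 h2 => (h i ?_).symm) n ?_).symm
  · exact Finset.mem_Icc.2 ⟨by omega, by omega⟩
  · exact mem_Icc.2 ⟨by omega, by omega⟩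

end Propagation

lemma IsBlockingCylinder.metricEntropy_eq_zero {A : Type*} [Fintype A] [MeasurableSpace A]
    [MeasurableSingletonClass A] {X : Set (ℤ → A)} {F : (ℤ → A) → (ℤ → A)} {r k : ℕ}
    {x₀ : ℤ → A} (hB : IsBlockingCylinder X F r k x₀) (hF : HasLocalRule F r)
    (hXσ : shiftMap A '' X = X) (hXm : MeasurableSet X) {μ : Measure (ℤ → A)}
    [IsProbabilityMeasure μ] (herg : Ergodic (shiftMap A) μ) (hFinv : MeasurePreserving F μ μ)
    (hμX : μ Xᶜ = 0) (hpos : μ (centralCylinder x₀ k) ≠ 0) : metricEntropy μ F = 0 := by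
  refine _root_.metricEntropy_eq_zero fun m α hα => ?_
  refine entropyPart_eq_zero hFinv.measurable hα fun ε hε => ?_
  obtain ⟨p, G, hG, hGε, hdet⟩ := exists_measurableSet_determined μ hα (half_pos hε)
  have hC := measurableSet_centralCylinder x₀ k
  have hXae : ∀ᵐ x ∂μ, x ∈ X := by simpa [ae_iff, compl_def] using hμX
  obtain ⟨N, hN⟩ := exists_measureReal_compl_le (μ := μ)
    (E := fun N => X ∩ (visitsLeft (centralCylinder x₀ k) p N
      ∩ visitsRight (centralCylinder x₀ k) p N))
    (fun N => hXm.inter ((measurableSet_visitsLeft hC p N).inter (measurableSet_visitsRight hC p N)))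
    (fun a b hab => inter_subset_inter_right _
      (inter_subset_inter (visitsLeft_mono _ _ hab) (visitsRight_mono _ _ hab)))
    (by
      filter_upwards [hXae, ae_exists_mem_visitsLeft herg hC hpos p,
        ae_exists_mem_visitsRight herg hC hpos p] with x hx ⟨a, ha⟩ ⟨b, hb⟩
      exact ⟨max a b, hx, visitsLeft_mono _ _ (le_max_left a b) ha,
        visitsRight_mono _ _ (le_max_right a b) hb⟩) (half_pos hε)
  set E : Set (ℤ → A) := X ∩ (visitsLeft (centralCylinder x₀ k) p N
      ∩ visitsRight (centralCylinder x₀ k) p N) with hE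
  have hEm : MeasurableSet E :=
    hXm.inter ((measurableSet_visitsLeft hC p N).inter (measurableSet_visitsRight hC p N))
  refine ⟨Finset.Icc (-(N + k) : ℤ) (N + k) → A, inferInstance,
    fun x i => x i, fun i => E ∩ F^[i] ⁻¹' G, fun j => ?_, fun i => ?_, fun i => ?_, ?_⟩
  · exact (measurable_pi_lambda _ fun i => measurable_pi_apply _) (measurableSet_singleton j)
  · exact hEm.inter (hFinv.measurable.iterate i hG)
  · rw [compl_inter]
    refine (measureReal_union_le _ _).trans ?_
    rw [← preimage_compl, (hFinv.iterate i).measureReal_preimage hG.compl.nullMeasurableSet]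
    linarith
  · rintro i x ⟨⟨hxX, hxl, hxr⟩, hxG⟩ y ⟨⟨hyX, -⟩, hyG⟩ hxy
    exact hdet _ hxG _ hyG fun j hj =>
      hB.iterate_eq_of_visits hF hXσ hxX hyX hxl hxr (fun l hl => congrFun hxy ⟨l, hl⟩) i hj

/-- If `F` has an equicontinuous point in `S(μ)`, then the average Lyapunov
exponents and the metric entropy of `F` all vanish. -/
theorem stmt10 {A : Type*} [Fintype A] [TopologicalSpace A] [DiscreteTopology A]
    [MeasurableSpace A] [BorelSpace A]
    (X : Set (ℤ → A)) (hXcl : IsClosed X) (hXσ : shiftMap A '' X = X)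
    (F : (ℤ → A) → (ℤ → A)) (hFX : Set.MapsTo F X X) (hFc : Continuous F)
    (hFσ : ∀ x, F (shiftMap A x) = shiftMap A (F x))
    (r : ℕ) (hr : 1 ≤ r) (hloc : HasLocalRule F r)
    (μ : Measure (ℤ → A)) [IsProbabilityMeasure μ]
    (herg : Ergodic (shiftMap A) μ) (hFinv : MeasurePreserving F μ μ)
    (hsuppX : msupp μ ⊆ X)
    (hec : ∃ x ∈ msupp μ, IsEquicontPt X F x) :
    avgIplus X F μ = 0 ∧ avgIminus X F μ = 0 ∧ metricEntropy μ F = 0 := by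
  obtain ⟨x₀, hx₀, hx₀ec⟩ := hec
  obtain ⟨k, hk⟩ := hx₀ec r
  have hB : IsBlockingCylinder X F r k x₀ := hk
  have hC := measurableSet_centralCylinder x₀ k
  have hpos : μ (centralCylinder x₀ k) ≠ 0 :=
    (hx₀ _ (isOpen_centralCylinder x₀ k) fun _ _ => rfl).ne'
  have hμX := measure_compl_eq_zero_of_msupp_subset hsuppX
  have hXae : ∀ᵐ x ∂μ, x ∈ X := by simpa [ae_iff, compl_def] using hμX
  refine ⟨?_, ?_, hB.metricEntropy_eq_zero hloc hXσ hXcl.measurableSet herg hFinv hμX hpos⟩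
  · refine liminf_integral_div_eq_zero (measurableSet_visitsLeft hC 0) (visitsLeft_mono _ 0)
      (ae_exists_mem_visitsLeft herg hC hpos 0) (ae_of_all _ fun x n => Iplus_le_mul hloc hFX n x)
      ?_ (c := k)
    filter_upwards [hXae] with x hx N n hxN
    exact hB.Iplus_le hloc hXσ hFX hx hxN n
  · refine liminf_integral_div_eq_zero (measurableSet_visitsRight hC 0) (visitsRight_mono _ 0)
      (ae_exists_mem_visitsRight herg hC hpos 0)
      (ae_of_all _ fun x n => Iminus_le_mul hloc hFX n x) ?_ (c := k)
    filter_upwards [hXae] with x hx N n hxN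
    exact hB.Iminus_le hloc hXσ hFX hx hxN n
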